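/- arXiv:1804.11244 — 3 statements merged into one kernel-verified Lean document; each statement's English description precedes it below -/
import Mathlib

section
/- Fix a natural number m ≥ 1 and work in ℚ⟦τ⟧. Suppose L₁, L₂, …, L_{2m+1} ∈ ℚ⟦τ⟧ satisfy L_{2m+1} = τ, L_{2m} = τ²·L₁, and L_i = τ·L₁·L_{i+1} + τ·L_{i+2} for all 1 ≤ i ≤ 2m−1. Then L₁ = Σ_{j=0}^{m} C(m+j, m−j) · τ^{j+m+1} · L₁^{2j}. -/
/-- The homogeneous Fibonacci-type polynomial `∑ C(i, s) xⁱ yⁱ⁻ˢ`, summed over `i + s = n`. -/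
def fibSum {R : Type*} [CommSemiring R] (x y : R) (n : ℕ) : R :=
  ∑ p ∈ Finset.HasAntidiagonal.antidiagonal n, (p.1.choose p.2 : R) * x ^ p.1 * y ^ (p.1 - p.2)

theorem fibSum_add_two {R : Type*} [CommSemiring R] (x y : R) (n : ℕ) :
    fibSum x y (n + 2) = x * y * fibSum x y (n + 1) + x * fibSum x y n := by
  have hterm : ∀ p : ℕ × ℕ,
      ((p.1 + 1).choose (p.2 + 1) : R) * x ^ (p.1 + 1) * y ^ (p.1 + 1 - (p.2 + 1)) =
        x * y * ((p.1.choose (p.2 + 1) : R) * x ^ p.1 * y ^ (p.1 - (p.2 + 1))) +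
          x * ((p.1.choose p.2 : R) * x ^ p.1 * y ^ (p.1 - p.2)) := by
    rintro ⟨i, s⟩
    rcases lt_or_ge s i with h | h
    · obtain ⟨d, rfl⟩ := Nat.exists_eq_add_of_lt h
      have h1 : s + d + 1 + 1 - (s + 1) = d + 1 := by lia
      have h2 : s + d + 1 - (s + 1) = d := by lia
      have h3 : s + d + 1 - s = d + 1 := by lia
      simp only [h1, h2, h3, Nat.choose_succ_succ (s + d + 1) s, Nat.cast_add]
      ring
    · simp only [Nat.choose_succ_succ i s, Nat.choose_eq_zero_of_lt (show i < s + 1 by lia),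
        Nat.add_sub_add_right, add_zero, Nat.cast_zero]
      ring
  unfold fibSum
  rw [Finset.Nat.antidiagonal_succ_succ', Finset.Nat.antidiagonal_succ' (n := n)]
  simp only [Finset.sum_cons, Finset.sum_map, Function.Embedding.coe_prodMap, Prod.map_fst,
    Prod.map_snd, Function.Embedding.coeFn_mk, Function.Embedding.refl_apply, Nat.succ_eq_add_one,
    hterm, Finset.sum_add_distrib, ← Finset.mul_sum, Nat.choose_zero_right,
    Nat.choose_zero_succ, Nat.cast_zero, Nat.cast_one, Nat.sub_zero]
  ring

theorem fibSum_two_mul {R : Type*} [CommSemiring R] (x y : R) (m : ℕ) :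
    fibSum x y (2 * m) = ∑ j ∈ Finset.range (m + 1),
      ((m + j).choose (m - j) : R) * x ^ (m + j) * y ^ (2 * j) := by
  unfold fibSum
  rw [Finset.Nat.sum_antidiagonal_eq_sum_range_succ_mk,
    show (2 * m).succ = m + (m + 1) by lia, Finset.sum_range_add, Finset.sum_eq_zero, zero_add]
  · refine Finset.sum_congr rfl fun j hj => ?_
    have hj : j < m + 1 := Finset.mem_range.mp hj
    rw [show 2 * m - (m + j) = m - j by lia, show m + j - (m - j) = 2 * j by lia]
  · intro i hi
    have hi : i < m := Finset.mem_range.mp hi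
    simp [Nat.choose_eq_zero_of_lt (show i < 2 * m - i by lia)]

/-- Proposition 1 (first identity): the generating function L₁ of Duchon's grammar
satisfies L₁ = Σ_{j=0}^{m} C(m+j, m−j) τ^{j+m+1} L₁^{2j}. -/
theorem stmt1 (m : ℕ) (hm : 1 ≤ m) (L : ℕ → PowerSeries ℚ)
    (htop : L (2 * m + 1) = PowerSeries.X)
    (hnext : L (2 * m) = PowerSeries.X ^ 2 * L 1)
    (hrec : ∀ i, 1 ≤ i → i ≤ 2 * m - 1 →
      L i = PowerSeries.X * L 1 * L (i + 1) + PowerSeries.X * L (i + 2)) :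
    L 1 = ∑ j ∈ Finset.range (m + 1),
      ((m + j).choose (m - j) : PowerSeries ℚ) * PowerSeries.X ^ (j + m + 1)
        * (L 1) ^ (2 * j) := by
  have key : ∀ k i, i + k = 2 * m + 1 → 1 ≤ i →
      L i = PowerSeries.X * fibSum PowerSeries.X (L 1) k := by
    intro k
    induction k using Nat.twoStepInduction with
    | zero =>
      intro i hi _
      rw [show i = 2 * m + 1 by lia, htop]
      simp [fibSum]
    | one =>
      intro i hi _
      rw [show i = 2 * m by lia, hnext]
      simp [fibSum, Finset.Nat.antidiagonal_succ]
      ring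
    | more k ih₀ ih₁ =>
      intro i hi hi1
      rw [hrec i hi1 (by lia), ih₁ (i + 1) (by lia) (by lia), ih₀ (i + 2) (by lia) (by lia),
        fibSum_add_two]
      ring
  refine (key (2 * m) 1 (by lia) le_rfl).trans ?_
  rw [fibSum_two_mul, Finset.mul_sum]
  exact Finset.sum_congr rfl fun j _ => by ring
end

section
/- Fix a natural number m ≥ 1 and work in ℚ⟦τ⟧. Suppose L₁, L₂, …, L_{2m+1} ∈ ℚ⟦τ⟧ satisfy L_{2m+1} = τ, L_{2m} = τ²·L₁, and L_i = τ·L₁·L_{i+1} + τ·L_{i+2} for all 1 ≤ i ≤ 2m−1. Then L₂ = Σ_{j=0}^{m−1} C(m+j, m−j−1) · τ^{j+m+1} · L₁^{2j+1}. -/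
open Finset in
/-- The solution of `u (k + 2) = x * y * u (k + 1) + x * u k`, `u 0 = x`, `u 1 = x ^ 2 * y`,
as a sum over a shallow diagonal of Pascal's triangle. -/
theorem eq_sum_antidiagonal_choose_of_recurrence {R : Type*} [CommRing R] (x y : R) (u : ℕ → R)
    (N : ℕ) (h0 : u 0 = x) (h1 : u 1 = x ^ 2 * y)
    (hu : ∀ k, k + 2 ≤ N → u (k + 2) = x * y * u (k + 1) + x * u k) (k : ℕ) (hk : k ≤ N) :
    u k = ∑ p ∈ antidiagonal k, (p.1.choose p.2 : R) * x ^ (p.1 + 1) * y ^ (p.1 - p.2) := by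
  induction k using Nat.twoStepInduction with
  | zero => simp [h0]
  | one => simp [h1, Finset.Nat.antidiagonal_succ]
  | more k ih0 ih1 =>
    rw [hu k hk, ih0 (by lia), ih1 (by lia), Finset.Nat.sum_antidiagonal_succ (n := k + 1),
      Finset.Nat.sum_antidiagonal_succ', Finset.Nat.sum_antidiagonal_succ', mul_add, mul_sum, mul_sum]
    have key : ∀ a s : ℕ, (((a + 1).choose (s + 1) : ℕ) : R) * x ^ (a + 1 + 1) *
        y ^ (a + 1 - (s + 1)) = x * y * ((a.choose (s + 1) : R) * x ^ (a + 1) * y ^ (a - (s + 1)))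
        + x * ((a.choose s : R) * x ^ (a + 1) * y ^ (a - s)) := by
      intro a s
      rw [Nat.choose_succ_succ, Nat.add_sub_add_right]
      rcases lt_or_ge s a with h | h
      · obtain ⟨d, rfl⟩ := Nat.exists_eq_add_of_lt h
        rw [show s + d + 1 - s = d + 1 by lia, show s + d + 1 - (s + 1) = d by lia]
        push_cast
        ring
      · rw [Nat.choose_eq_zero_of_lt (by lia : a < s + 1)]
        push_cast
        ring
    simp only [key, sum_add_distrib, Nat.choose_zero_succ, Nat.choose_zero_right]
    simp
    ring

/-- Proposition 1 (second identity): the generating function L₂ of Duchon's grammar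
satisfies L₂ = Σ_{j=0}^{m-1} C(m+j, m−j−1) τ^{j+m+1} L₁^{2j+1}. -/
theorem stmt2 (m : ℕ) (hm : 1 ≤ m) (L : ℕ → PowerSeries ℚ)
    (htop : L (2 * m + 1) = PowerSeries.X)
    (hnext : L (2 * m) = PowerSeries.X ^ 2 * L 1)
    (hrec : ∀ i, 1 ≤ i → i ≤ 2 * m - 1 →
      L i = PowerSeries.X * L 1 * L (i + 1) + PowerSeries.X * L (i + 2)) :
    L 2 = ∑ j ∈ Finset.range m,
      ((m + j).choose (m - j - 1) : PowerSeries ℚ) * PowerSeries.X ^ (j + m + 1)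
        * (L 1) ^ (2 * j + 1) := by
  have h := eq_sum_antidiagonal_choose_of_recurrence PowerSeries.X (L 1)
    (fun k => L (2 * m + 1 - k)) (2 * m) htop hnext
    (fun k hk => by
      have h := hrec (2 * m + 1 - (k + 2)) (by lia) (by lia)
      rwa [show 2 * m + 1 - (k + 2) + 1 = 2 * m + 1 - (k + 1) by lia,
        show 2 * m + 1 - (k + 2) + 2 = 2 * m + 1 - k by lia] at h)
    (2 * m - 1) (by lia)
  simp only [show 2 * m + 1 - (2 * m - 1) = 2 by lia] at h
  rw [h, Finset.Nat.sum_antidiagonal_eq_sum_range_succ_mk,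
    show (2 * m - 1).succ = m + m by lia, Finset.sum_range_add, Finset.sum_eq_zero, zero_add]
  · refine Finset.sum_congr rfl fun j hj => ?_
    rw [Finset.mem_range] at hj
    simp only [show 2 * m - 1 - (m + j) = m - j - 1 by lia,
      show m + j - (m - j - 1) = 2 * j + 1 by lia, add_comm j m]
  · intro i hi
    rw [Finset.mem_range] at hi
    simp only [Nat.choose_eq_zero_of_lt (show i < 2 * m - 1 - i by lia), Nat.cast_zero, zero_mul]
end

section
/- Fix a natural number m ≥ 1 and let h be the valuation on words over {a,b} with h(a) = 2m+1, h(b) = −2, extended additively. Let w and w′ be nonempty factor-free generalized Dyck words, and let u be a nonempty word that is a prefix of w with u ≠ w. Then u is not a suffix of w′. In particular, any set of factor-free generalized Dyck words with slope (2m+1)/2 is cross-bifix-free. -/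
/-- The valuation of a word over {a,b}: h(a) = 2m+1, h(b) = −2, extended additively.
Here the letter `a` is encoded by `true` and `b` by `false`. -/
def wordVal (m : ℕ) (w : List Bool) : ℤ :=
  (w.map (fun c => if c then (2 * m + 1 : ℤ) else -2)).sum

/-- A generalized Dyck word: total valuation 0 and every prefix has valuation ≥ 0. -/
def IsDyck (m : ℕ) (w : List Bool) : Prop :=
  wordVal m w = 0 ∧ ∀ p : List Bool, p <+: w → 0 ≤ wordVal m p

/-- A word is factor-free if no nonempty proper factor of it is a generalized
Dyck word. -/
def FactorFree (m : ℕ) (w : List Bool) : Prop :=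
  ∀ w₁ w' w₂ : List Bool, w = w₁ ++ w' ++ w₂ → w' ≠ [] → ¬(w₁ = [] ∧ w₂ = []) →
    ¬ IsDyck m w'

theorem wordVal_append (m : ℕ) (x y : List Bool) :
    wordVal m (x ++ y) = wordVal m x + wordVal m y := by
  simp [wordVal]

/-- Every suffix of a generalized Dyck word has nonpositive valuation. -/
theorem IsDyck.wordVal_suffix_nonpos {m : ℕ} {w u : List Bool} (hw : IsDyck m w)
    (hu : u <:+ w) : wordVal m u ≤ 0 := by
  obtain ⟨p, rfl⟩ := hu
  have hp := hw.2 p (List.prefix_append p u)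
  have hpu := hw.1
  rw [wordVal_append] at hpu
  linarith

/-- No nonempty proper prefix of a factor-free Dyck word is a suffix of a
factor-free Dyck word: factor-free Dyck words form a cross-bifix-free set. -/
theorem stmt17 (m : ℕ) (hm : 1 ≤ m) (w w' : List Bool)
    (hwne : w ≠ []) (hwd : IsDyck m w) (hwff : FactorFree m w)
    (hw'ne : w' ≠ []) (hw'd : IsDyck m w') (hw'ff : FactorFree m w')
    (u : List Bool) (hune : u ≠ []) (hupre : u <+: w) (hune' : u ≠ w) :
    ¬ u <:+ w' := by
  intro hsuf
  have hu : IsDyck m u :=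
    ⟨le_antisymm (hw'd.wordVal_suffix_nonpos hsuf) (hwd.2 u hupre),
      fun p hp => hwd.2 p (hp.trans hupre)⟩
  obtain ⟨t, rfl⟩ := hupre
  refine hwff [] u t (by simp) hune ?_ hu
  rintro ⟨-, rfl⟩
  simp at hune'
end
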